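/- (Lemma 3.1.) Assume (X,d) is a proper, geodesic, non-branching complete separable metric space and the Borel measure m satisfies the evolution estimate with rate f. Let Λ₁,Λ₂⊂Γ be compact sets such that P₁(Λ₁)=P₁(Λ₂) and P₂(Λ₁)∩P₂(Λ₂)=∅. Then m(P₁(Λ₁))=m(P₁(Λ₂))=0. -/

import Mathlib

open Set Metric MeasureTheory

/-- A geodesic parametrized on `[0,1]`: `d(γ_s,γ_t) = |s-t| · d(γ_0,γ_1)`. -/
def IsGeodesic {X : Type*} [MetricSpace X] (γ : ℝ → X) : Prop :=
  ∀ s ∈ Set.Icc (0:ℝ) 1, ∀ t ∈ Set.Icc (0:ℝ) 1,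
    dist (γ s) (γ t) = |s - t| * dist (γ 0) (γ 1)

/-- A geodesic metric space: every pair of points is joined by a geodesic. -/
def GeodesicMetricSpace (X : Type*) [MetricSpace X] : Prop :=
  ∀ x y : X, ∃ γ : ℝ → X, IsGeodesic γ ∧ γ 0 = x ∧ γ 1 = y

/-- Non-branching: two geodesics agreeing on `[0,t]` for some `t ∈ (0,1)` agree on `[0,1]`. -/
def NonBranching (X : Type*) [MetricSpace X] : Prop :=
  ∀ γ₁ γ₂ : ℝ → X, IsGeodesic γ₁ → IsGeodesic γ₂ →
    ∀ t ∈ Set.Ioo (0:ℝ) 1, (∀ s ∈ Set.Icc (0:ℝ) t, γ₁ s = γ₂ s) →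
      ∀ s ∈ Set.Icc (0:ℝ) 1, γ₁ s = γ₂ s

/-- The evolution set `A_{t,Λ} = {γ_t : γ geodesic, γ_0 ∈ A, (γ_0,γ_1) ∈ Λ}`. -/
def evoSet {X : Type*} [MetricSpace X] (A : Set X) (Λ : Set (X × X)) (t : ℝ) : Set X :=
  {z | ∃ γ : ℝ → X, IsGeodesic γ ∧ γ 0 ∈ A ∧ (γ 0, γ 1) ∈ Λ ∧ γ t = z}

/-- `m` satisfies the evolution estimate with rate `f` (a consequence of `MCP(K,N)`):
`f : [0,1] → [0,1]` is continuous, `f(0) = 1`, and `m(E_{t,E×{y}}) ≥ f(t)·m(E)` for every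
compact `E`, every `y` and every `t ∈ [0,1]`. -/
def EvolutionEstimate {X : Type*} [MetricSpace X] [MeasurableSpace X]
    (m : Measure X) (f : ℝ → ℝ) : Prop :=
  ContinuousOn f (Set.Icc 0 1) ∧ f 0 = 1 ∧
    (∀ t ∈ Set.Icc (0:ℝ) 1, f t ∈ Set.Icc (0:ℝ) 1) ∧
    ∀ E : Set X, IsCompact E → ∀ y : X, ∀ t ∈ Set.Icc (0:ℝ) 1,
      ENNReal.ofReal (f t) * m E ≤ m (evoSet E (E ×ˢ ({y} : Set X)) t)

/-- The contact set `Γ = {(x,y) ∈ K × K : φ(x) + φᶜ(y) = c(x,y)}`. -/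
def contactSet {X : Type*} [MetricSpace X] (h : ℝ → ℝ) (φ φc : X → ℝ) (K : Set X) :
    Set (X × X) :=
  {p | p.1 ∈ K ∧ p.2 ∈ K ∧ φ p.1 + φc p.2 = h (dist p.1 p.2)}

section Convexity

variable {h : ℝ → ℝ}

lemma StrictConvexOn.strictMonoOn_Ici_of_monotoneOn (hconv : StrictConvexOn ℝ (Ici (0 : ℝ)) h)
    (hmono : MonotoneOn h (Ici (0 : ℝ))) : StrictMonoOn h (Ici (0 : ℝ)) := by
  intro a ha b hb hab
  by_contra! hle
  have hmem : (1 / 2 : ℝ) • a + (1 / 2 : ℝ) • b ∈ Ici (0 : ℝ) := by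
    simp only [mem_Ici, smul_eq_mul] at *
    linarith
  have h₁ := hconv.2 ha hb hab.ne (by norm_num : (0 : ℝ) < 1 / 2)
    (by norm_num : (0 : ℝ) < 1 / 2) (by norm_num)
  have h₂ := hmono ha hmem (by simp only [smul_eq_mul]; linarith)
  simp only [smul_eq_mul] at h₁ h₂
  linarith

lemma ConvexOn.continuousOn_Ici_of_monotoneOn (hconv : ConvexOn ℝ (Ici (0 : ℝ)) h)
    (hmono : MonotoneOn h (Ici (0 : ℝ))) : ContinuousOn h (Ici (0 : ℝ)) := by
  intro x hx
  rcases (mem_Ici.1 hx).eq_or_lt with rfl | hx0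
  · have hupper : Filter.Tendsto (fun x : ℝ => (1 - x) * h 0 + x * h 1)
        (nhdsWithin 0 (Ici 0)) (nhds (h 0)) := by
      have hc : Continuous fun x : ℝ => (1 - x) * h 0 + x * h 1 := by fun_prop
      simpa using (hc.tendsto 0).mono_left nhdsWithin_le_nhds
    refine tendsto_of_tendsto_of_tendsto_of_le_of_le' tendsto_const_nhds hupper ?_ ?_
    · filter_upwards [self_mem_nhdsWithin] with y hy
      exact hmono hx hy hy
    · filter_upwards [self_mem_nhdsWithin, mem_nhdsWithin_of_mem_nhds (Iio_mem_nhds zero_lt_one)]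
        with y hy hy1
      have := hconv.2 hx (show (1 : ℝ) ∈ Ici (0 : ℝ) by simp)
        (sub_nonneg.2 (le_of_lt hy1)) hy (by ring)
      simpa using this
  · have hint := (hconv.subset Ioi_subset_Ici_self (convex_Ioi 0)).continuousOn isOpen_Ioi
    exact (hint.continuousAt (Ioi_mem_nhds hx0)).continuousWithinAt

end Convexity

section Geodesics

variable {X : Type*} [MetricSpace X]

/-- The points dividing some pair of `S` in the ratio `t : 1 - t`. -/
def divisionPoints (S : Set (X × X)) (t : ℝ) : Set X :=
  {z | ∃ p ∈ S, dist p.1 z = t * dist p.1 p.2 ∧ dist z p.2 = (1 - t) * dist p.1 p.2}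

lemma divisionPoints_mono {S T : Set (X × X)} (hST : S ⊆ T) (t : ℝ) :
    divisionPoints S t ⊆ divisionPoints T t := by
  rintro z ⟨p, hp, hz⟩
  exact ⟨p, hST hp, hz⟩

lemma evoSet_subset_divisionPoints (A : Set X) (S : Set (X × X)) {t : ℝ}
    (ht : t ∈ Icc (0 : ℝ) 1) : evoSet A S t ⊆ divisionPoints S t := by
  rintro z ⟨γ, hγ, -, hS, rfl⟩
  refine ⟨_, hS, ?_, ?_⟩
  · simpa [abs_of_nonneg ht.1] using hγ 0 (by simp) t ht
  · have := hγ t ht 1 (by simp)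
    rwa [abs_sub_comm, abs_of_nonneg (sub_nonneg.2 ht.2)] at this

lemma isClosed_setOf_division (t : ℝ) (z : X) :
    IsClosed {p : X × X | dist p.1 z = t * dist p.1 p.2 ∧ dist z p.2 = (1 - t) * dist p.1 p.2} :=
  (isClosed_eq (by fun_prop) (by fun_prop)).inter (isClosed_eq (by fun_prop) (by fun_prop))

lemma divisionPoints_iInter_of_antitone {S : ℕ → Set (X × X)} (hS : ∀ n, IsCompact (S n))
    (hanti : Antitone S) (t : ℝ) :
    ⋂ n, divisionPoints (S n) t ⊆ divisionPoints (⋂ n, S n) t := by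
  intro z hz
  set C := {p : X × X | dist p.1 z = t * dist p.1 p.2 ∧ dist z p.2 = (1 - t) * dist p.1 p.2}
  have hC : IsClosed C := isClosed_setOf_division t z
  obtain ⟨p, hp⟩ := IsCompact.nonempty_iInter_of_sequence_nonempty_isCompact_isClosed
    (fun n => S n ∩ C) (fun n => inter_subset_inter_left _ (hanti n.le_succ))
    (fun n => by
      obtain ⟨p, hp, hpz⟩ := mem_iInter.1 hz n
      exact ⟨p, hp, hpz⟩)
    ((hS 0).inter_right hC) (fun n => (hS n).isClosed.inter hC)
  rw [mem_iInter] at hp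
  exact ⟨p, mem_iInter.2 fun n => (hp n).1, (hp 0).2⟩

lemma divisionPoints_subset_cthickening {A : Set X} {S : Set (X × X)} {R t : ℝ} (ht : 0 ≤ t)
    (hA : ∀ p ∈ S, p.1 ∈ A) (hR : ∀ p ∈ S, dist p.1 p.2 ≤ R) :
    divisionPoints S t ⊆ cthickening (t * R) A := by
  rintro z ⟨p, hp, hz, -⟩
  refine mem_cthickening_of_dist_le z p.1 _ A (hA p hp) ?_
  rw [dist_comm, hz]
  exact mul_le_mul_of_nonneg_left (hR p hp) ht

lemma IsCompact.divisionPoints [ProperSpace X] {S : Set (X × X)} (hS : IsCompact S) (t : ℝ) :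
    IsCompact (divisionPoints S t) := by
  obtain ⟨R, hR⟩ := hS.bddAbove_image (f := fun p : X × X => |t| * dist p.1 p.2) (by fun_prop)
  have hA : IsCompact (Prod.fst '' S) := hS.image continuous_fst
  have hB : IsCompact (cthickening R (Prod.fst '' S)) := hA.cthickening
  have hclosed : IsClosed {q : (X × X) × X | dist q.1.1 q.2 = t * dist q.1.1 q.1.2 ∧
      dist q.2 q.1.2 = (1 - t) * dist q.1.1 q.1.2} :=
    (isClosed_eq (by fun_prop) (by fun_prop)).inter (isClosed_eq (by fun_prop) (by fun_prop))
  convert ((hS.prod hB).inter_right hclosed).image continuous_snd using 1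
  ext z
  constructor
  · rintro ⟨p, hp, hz⟩
    refine ⟨(p, z), ⟨⟨hp, ?_⟩, hz⟩, rfl⟩
    refine mem_cthickening_of_dist_le z p.1 _ _ (mem_image_of_mem _ hp) ?_
    rw [dist_comm, hz.1]
    exact (mul_le_mul_of_nonneg_right (le_abs_self t) dist_nonneg).trans
      (hR (mem_image_of_mem _ hp))
  · rintro ⟨⟨p, z⟩, ⟨⟨hp, -⟩, hz⟩, rfl⟩
    exact ⟨p, hp, hz⟩

lemma isGeodesic_of_dist_le {γ : ℝ → X}
    (hγ : ∀ s ∈ Icc (0 : ℝ) 1, ∀ t ∈ Icc (0 : ℝ) 1, s ≤ t →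
      dist (γ s) (γ t) ≤ (t - s) * dist (γ 0) (γ 1)) : IsGeodesic γ := by
  have key : ∀ s ∈ Icc (0 : ℝ) 1, ∀ t ∈ Icc (0 : ℝ) 1, s ≤ t →
      dist (γ s) (γ t) = (t - s) * dist (γ 0) (γ 1) := by
    intro s hs t ht hst
    have h₁ := hγ 0 (by simp) s hs hs.1
    have h₂ := hγ t ht 1 (by simp) ht.2
    have h₃ := dist_triangle4 (γ 0) (γ s) (γ t) (γ 1)
    refine le_antisymm (hγ s hs t ht hst) ?_
    linarith
  intro s hs t ht
  rcases le_total s t with hst | hts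
  · rw [key s hs t ht hst, abs_sub_comm, abs_of_nonneg (sub_nonneg.2 hst)]
  · rw [dist_comm, key t ht s hs hts, abs_of_nonneg (sub_nonneg.2 hts)]

/-- The concatenation of two curves on `[0,1]`, switching at time `t`. -/
noncomputable def concatAt (α β : ℝ → X) (t : ℝ) : ℝ → X :=
  fun s => if s ≤ t then α (s / t) else β ((s - t) / (1 - t))

lemma isGeodesic_concatAt {α β : ℝ → X} (hα : IsGeodesic α) (hβ : IsGeodesic β) {t : ℝ}
    (ht : t ∈ Ioo (0 : ℝ) 1) (hαβ : α 1 = β 0)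
    (h₁ : dist (α 0) (α 1) = t * dist (α 0) (β 1))
    (h₂ : dist (β 0) (β 1) = (1 - t) * dist (α 0) (β 1)) :
    IsGeodesic (concatAt α β t) := by
  obtain ⟨ht0, ht1⟩ := ht
  have ht1' : 0 < 1 - t := sub_pos.2 ht1
  have e0 : concatAt α β t 0 = α 0 := by simp [concatAt, ht0.le]
  have e1 : concatAt α β t 1 = β 1 := by simp [concatAt, ht1.not_ge, div_self ht1'.ne']
  have hleft : ∀ r ∈ Icc (0 : ℝ) t, r / t ∈ Icc (0 : ℝ) 1 := fun r hr =>
    ⟨div_nonneg hr.1 ht0.le, (div_le_one ht0).2 hr.2⟩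
  have hright : ∀ r ∈ Icc t 1, (r - t) / (1 - t) ∈ Icc (0 : ℝ) 1 := fun r hr =>
    ⟨div_nonneg (sub_nonneg.2 hr.1) ht1'.le, (div_le_one ht1').2 (by linarith [hr.2])⟩
  have hdα : ∀ r ∈ Icc (0 : ℝ) t, ∀ s ∈ Icc (0 : ℝ) t, r ≤ s →
      dist (α (r / t)) (α (s / t)) = (s - r) * dist (α 0) (β 1) := by
    intro r hr s hs hrs
    rw [hα _ (hleft r hr) _ (hleft s hs), h₁, ← sub_div, abs_div, abs_of_pos ht0, abs_sub_comm,
      abs_of_nonneg (sub_nonneg.2 hrs)]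
    field_simp
  have hdβ : ∀ r ∈ Icc t 1, ∀ s ∈ Icc t 1, r ≤ s →
      dist (β ((r - t) / (1 - t))) (β ((s - t) / (1 - t))) = (s - r) * dist (α 0) (β 1) := by
    intro r hr s hs hrs
    rw [hβ _ (hright r hr) _ (hright s hs), h₂, ← sub_div, abs_div, abs_of_pos ht1',
      sub_sub_sub_cancel_right, abs_sub_comm, abs_of_nonneg (sub_nonneg.2 hrs)]
    field_simp
  refine isGeodesic_of_dist_le fun r hr s hs hrs => ?_
  rw [e0, e1]
  unfold concatAt
  split_ifs with hrt hst hst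
  · exact (hdα r ⟨hr.1, hrt⟩ s ⟨hs.1, hst⟩ hrs).le
  · have hst := (not_le.1 hst).le
    have a := hdα r ⟨hr.1, hrt⟩ t ⟨ht0.le, le_rfl⟩ hrt
    have b := hdβ t ⟨le_rfl, ht1.le⟩ s ⟨hst, hs.2⟩ hst
    rw [div_self ht0.ne', hαβ] at a
    rw [sub_self, zero_div] at b
    have := dist_triangle (α (r / t)) (β 0) (β ((s - t) / (1 - t)))
    linarith
  · exact absurd (hrs.trans hst) hrt
  · exact (hdβ r ⟨(not_le.1 hrt).le, hr.2⟩ s ⟨(not_le.1 hst).le, hs.2⟩ hrs).le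

lemma NonBranching.eq_of_common_divisionPoint (hnb : NonBranching X)
    (hgeo : GeodesicMetricSpace X) {x y₁ y₂ z : X} {t : ℝ} (ht : t ∈ Ioo (0 : ℝ) 1)
    (hx₁ : dist x z = t * dist x y₁) (hy₁ : dist z y₁ = (1 - t) * dist x y₁)
    (hx₂ : dist x z = t * dist x y₂) (hy₂ : dist z y₂ = (1 - t) * dist x y₂) : y₁ = y₂ := by
  obtain ⟨α, hα, hα0, hα1⟩ := hgeo x z
  obtain ⟨β₁, hβ₁, hβ₁0, hβ₁1⟩ := hgeo z y₁
  obtain ⟨β₂, hβ₂, hβ₂0, hβ₂1⟩ := hgeo z y₂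
  have g₁ : IsGeodesic (concatAt α β₁ t) :=
    isGeodesic_concatAt hα hβ₁ ht (by rw [hα1, hβ₁0]) (by rwa [hα0, hα1, hβ₁1])
      (by rwa [hα0, hβ₁0, hβ₁1])
  have g₂ : IsGeodesic (concatAt α β₂ t) :=
    isGeodesic_concatAt hα hβ₂ ht (by rw [hα1, hβ₂0]) (by rwa [hα0, hα1, hβ₂1])
      (by rwa [hα0, hβ₂0, hβ₂1])
  have := hnb _ _ g₁ g₂ t ht (fun s hs => by simp [concatAt, hs.2]) 1 (by simp)
  simpa [concatAt, ht.2.not_ge, div_self (sub_pos.2 ht.2).ne', hβ₁1, hβ₂1] using this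

/-- Two pairs that are cyclically monotone for the cost `h ∘ dist` and share a division point at
an interior time have the same target. -/
lemma eq_of_common_divisionPoint_of_cost_le {h : ℝ → ℝ} (hgeo : GeodesicMetricSpace X)
    (hnb : NonBranching X) (hconv : StrictConvexOn ℝ (Ici (0 : ℝ)) h)
    (hmono : MonotoneOn h (Ici (0 : ℝ))) {x₁ x₂ y₁ y₂ z : X} {t : ℝ} (ht : t ∈ Ioo (0 : ℝ) 1)
    (hcost : h (dist x₁ y₁) + h (dist x₂ y₂) ≤ h (dist x₁ y₂) + h (dist x₂ y₁))
    (hx₁ : dist x₁ z = t * dist x₁ y₁) (hy₁ : dist z y₁ = (1 - t) * dist x₁ y₁)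
    (hx₂ : dist x₂ z = t * dist x₂ y₂) (hy₂ : dist z y₂ = (1 - t) * dist x₂ y₂) : y₁ = y₂ := by
  have hstrict := hconv.strictMonoOn_Ici_of_monotoneOn hmono
  have ht1 : 0 < 1 - t := sub_pos.2 ht.2
  have hmem : ∀ a b : X, dist a b ∈ Ici (0 : ℝ) := fun a b => dist_nonneg
  have b₁₂ : dist x₁ y₂ ≤ t * dist x₁ y₁ + (1 - t) * dist x₂ y₂ := by
    linarith [dist_triangle x₁ z y₂]
  have b₂₁ : dist x₂ y₁ ≤ t * dist x₂ y₂ + (1 - t) * dist x₁ y₁ := by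
    linarith [dist_triangle x₂ z y₁]
  have heq : dist x₁ y₁ = dist x₂ y₂ := by
    by_contra hne
    have c₁ := hconv.2 (hmem x₁ y₁) (hmem x₂ y₂) hne ht.1 ht1 (by ring)
    have c₂ := hconv.2 (hmem x₂ y₂) (hmem x₁ y₁) (Ne.symm hne) ht.1 ht1 (by ring)
    simp only [smul_eq_mul] at c₁ c₂
    have m₁ := hmono (hmem x₁ y₂) ((hmem x₁ y₂).trans b₁₂) b₁₂
    have m₂ := hmono (hmem x₂ y₁) ((hmem x₂ y₁).trans b₂₁) b₂₁
    linarith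
  rw [← heq] at b₁₂ b₂₁ hcost hx₂ hy₂
  have b₁₂' : dist x₁ y₂ ≤ dist x₁ y₁ := by linarith
  have b₂₁' : dist x₂ y₁ ≤ dist x₁ y₁ := by linarith
  have heq' : dist x₁ y₂ = dist x₁ y₁ := by
    refine b₁₂'.eq_of_not_lt fun hlt => ?_
    have m₁ := hstrict (hmem x₁ y₂) (hmem x₁ y₁) hlt
    have m₂ := hmono (hmem x₂ y₁) (hmem x₁ y₁) b₂₁'
    linarith
  exact hnb.eq_of_common_divisionPoint hgeo ht hx₁ hy₁ (by rwa [heq']) (by rwa [heq'])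

end Geodesics

section Evolution

variable {X : Type*} [MetricSpace X]

lemma StrictConvexOn.continuous_comp_dist {h : ℝ → ℝ}
    (hconv : StrictConvexOn ℝ (Ici (0 : ℝ)) h) (hmono : MonotoneOn h (Ici (0 : ℝ))) :
    Continuous fun p : X × X => h (dist p.1 p.2) :=
  (hconv.convexOn.continuousOn_Ici_of_monotoneOn hmono).comp_continuous continuous_dist
    fun _ => dist_nonneg

/-- Pairs in `A × Y` whose cost exceeds `φ x + φc y` by at most `δ`. -/
def almostContactSet (h : ℝ → ℝ) (φ φc : X → ℝ) (A Y : Set X) (δ : ℝ) : Set (X × X) :=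
  {p | p ∈ A ×ˢ Y ∧ h (dist p.1 p.2) ≤ φ p.1 + φc p.2 + δ}

lemma isCompact_almostContactSet {h : ℝ → ℝ} (hconv : StrictConvexOn ℝ (Ici (0 : ℝ)) h)
    (hmono : MonotoneOn h (Ici (0 : ℝ))) {φ φc : X → ℝ} {A Y : Set X} (hA : IsCompact A)
    (hY : IsCompact Y) (hφ : ContinuousOn φ A) (hφc : ContinuousOn φc Y) (δ : ℝ) :
    IsCompact (almostContactSet h φ φc A Y δ) := by
  have hcont : ContinuousOn (fun p : X × X => h (dist p.1 p.2) - (φ p.1 + φc p.2 + δ))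
      (A ×ˢ Y) := by
    refine (hconv.continuous_comp_dist hmono).continuousOn.sub (ContinuousOn.add (.add ?_ ?_) ?_)
    · exact hφ.comp continuousOn_fst fun p hp => hp.1
    · exact hφc.comp continuousOn_snd fun p hp => hp.2
    · exact continuousOn_const
  have hclosed := hcont.preimage_isClosed_of_isClosed (hA.prod hY).isClosed
    (isClosed_Iic (a := (0 : ℝ)))
  refine (hA.prod hY).of_isClosed_subset (?_ : IsClosed _) fun p hp => hp.1
  convert hclosed using 1
  ext p
  simp [almostContactSet]

variable [MeasurableSpace X] [BorelSpace X] [ProperSpace X] {h : ℝ → ℝ} {m : Measure X} {f : ℝ → ℝ}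

/-- The evolution estimate when the mass of `A` is sent to finitely many targets, each point to a
target minimizing `h (dist x y) - ψ y`. -/
lemma EvolutionEstimate.mul_measure_le_of_finset (hm : EvolutionEstimate m f)
    (hgeo : GeodesicMetricSpace X) (hnb : NonBranching X)
    (hconv : StrictConvexOn ℝ (Ici (0 : ℝ)) h) (hmono : MonotoneOn h (Ici (0 : ℝ)))
    {A : Set X} (hA : IsCompact A) (Y : Finset X) (hY : A.Nonempty → Y.Nonempty) (ψ : X → ℝ)
    {t : ℝ} (ht : t ∈ Ioo (0 : ℝ) 1) :
    ENNReal.ofReal (f t) * m A ≤ m (divisionPoints {p | p.1 ∈ A ∧ p.2 ∈ Y ∧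
      ∀ y ∈ Y, h (dist p.1 p.2) - ψ p.2 ≤ h (dist p.1 y) - ψ y} t) := by
  have ht' : t ∈ Icc (0 : ℝ) 1 := Ioo_subset_Icc_self ht
  have hc (y : X) : Continuous fun x : X => h (dist x y) :=
    (hconv.continuous_comp_dist hmono).comp (by fun_prop : Continuous fun x : X => (x, y))
  set E : X → Set X := fun y => A ∩ ⋂ y' ∈ Y, {x | h (dist x y) - ψ y ≤ h (dist x y') - ψ y'}
    with hE
  have hEc (y : X) : IsCompact (E y) :=
    hA.inter_right <| isClosed_biInter fun y' _ =>
      isClosed_le ((hc y).sub continuous_const) ((hc y').sub continuous_const)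
  have hcover : A ⊆ ⋃ y ∈ Y, E y := by
    intro x hx
    obtain ⟨y, hy, hmin⟩ := Y.exists_min_image (fun y => h (dist x y) - ψ y) (hY ⟨x, hx⟩)
    simp only [hE, mem_iUnion, mem_inter_iff, mem_iInter]
    exact ⟨y, hy, hx, hmin⟩
  set F : X → Set X := fun y => divisionPoints (E y ×ˢ {y}) t
  have hFdisj : (Y : Set X).PairwiseDisjoint F := by
    intro y₁ hy₁ y₂ hy₂ hne
    refine Set.disjoint_left.2 ?_
    rintro z ⟨⟨x₁, w₁⟩, ⟨hx₁, hw₁⟩, hd₁, hd₁'⟩ ⟨⟨x₂, w₂⟩, ⟨hx₂, hw₂⟩, hd₂, hd₂'⟩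
    obtain rfl : w₁ = y₁ := hw₁
    obtain rfl : w₂ = y₂ := hw₂
    have i₁ := mem_iInter₂.1 hx₁.2 w₂ hy₂
    have i₂ := mem_iInter₂.1 hx₂.2 w₁ hy₁
    simp only [mem_ofPred_eq] at i₁ i₂
    exact hne (eq_of_common_divisionPoint_of_cost_le hgeo hnb hconv hmono ht (by linarith)
      hd₁ hd₁' hd₂ hd₂')
  calc ENNReal.ofReal (f t) * m A
      ≤ ENNReal.ofReal (f t) * ∑ y ∈ Y, m (E y) := by
        gcongr
        exact (measure_mono hcover).trans (measure_biUnion_finset_le Y E)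
    _ = ∑ y ∈ Y, ENNReal.ofReal (f t) * m (E y) := Finset.mul_sum ..
    _ ≤ ∑ y ∈ Y, m (F y) := Finset.sum_le_sum fun y _ =>
        (hm.2.2.2 (E y) (hEc y) y t ht').trans
          (measure_mono (evoSet_subset_divisionPoints _ _ ht'))
    _ = m (⋃ y ∈ Y, F y) := (measure_biUnion_finset hFdisj fun y _ =>
        (((hEc y).prod isCompact_singleton).divisionPoints t).measurableSet).symm
    _ ≤ _ := by
        refine measure_mono (iUnion₂_subset fun y hy => divisionPoints_mono ?_ t)
        rintro ⟨x, w⟩ ⟨hx, hw⟩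
        obtain rfl : w = y := hw
        exact ⟨hx.1, hy, fun y' hy' => mem_iInter₂.1 hx.2 y' hy'⟩

lemma EvolutionEstimate.mul_measure_le_almostContactSet (hm : EvolutionEstimate m f)
    (hgeo : GeodesicMetricSpace X) (hnb : NonBranching X)
    (hconv : StrictConvexOn ℝ (Ici (0 : ℝ)) h) (hmono : MonotoneOn h (Ici (0 : ℝ)))
    {φ φc : X → ℝ} {A Y : Set X} (hA : IsCompact A) (hφ : ContinuousOn φ A)
    (hcontact : ∀ x ∈ A, ∃ y ∈ Y, φ x + φc y = h (dist x y)) {δ : ℝ} (hδ : 0 < δ)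
    {t : ℝ} (ht : t ∈ Ioo (0 : ℝ) 1) :
    ENNReal.ofReal (f t) * m A ≤ m (divisionPoints (almostContactSet h φ φc A Y δ) t) := by
  classical
  choose! g hgY hg using hcontact
  obtain ⟨s, hsA, hs⟩ := hA.elim_nhdsWithin_subcover
    (fun x => {x' | h (dist x' (g x)) - φ x' < φc (g x) + δ}) fun x hx => by
      have hc : ContinuousWithinAt (fun x' => h (dist x' (g x)) - φ x') A x :=
        ((hconv.continuous_comp_dist hmono).comp
          (by fun_prop : Continuous fun x' : X => (x', g x))).continuousWithinAt.sub (hφ x hx)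
      refine hc.eventually_lt_const ?_
      linarith [hg x hx]
  have hcover : ∀ x ∈ A, ∃ y ∈ s.image g, h (dist x y) - φc y ≤ φ x + δ := by
    intro x hx
    obtain ⟨x', hx', hlt⟩ := mem_iUnion₂.1 (hs hx)
    simp only [mem_ofPred_eq] at hlt
    exact ⟨g x', Finset.mem_image_of_mem g hx', by linarith⟩
  refine (hm.mul_measure_le_of_finset hgeo hnb hconv hmono hA (s.image g) ?_ φc ht).trans
    (measure_mono (divisionPoints_mono ?_ t))
  · rintro ⟨x, hx⟩
    obtain ⟨y, hy, -⟩ := hcover x hx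
    exact ⟨y, hy⟩
  · rintro ⟨x, y⟩ ⟨hx, hy, hmin⟩
    obtain ⟨y', hy', hle⟩ := hcover x hx
    obtain ⟨x', hx', hxy⟩ := Finset.mem_image.1 hy
    have := hmin y' hy'
    refine ⟨⟨hx, hxy ▸ hgY x' (hsA x' hx')⟩, ?_⟩
    simp only at *
    linarith

lemma EvolutionEstimate.mul_measure_le [IsFiniteMeasureOnCompacts m] (hm : EvolutionEstimate m f)
    (hgeo : GeodesicMetricSpace X) (hnb : NonBranching X)
    (hconv : StrictConvexOn ℝ (Ici (0 : ℝ)) h) (hmono : MonotoneOn h (Ici (0 : ℝ)))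
    {φ φc : X → ℝ} {A Y : Set X} (hA : IsCompact A) (hY : IsCompact Y) (hφ : ContinuousOn φ A)
    (hφc : ContinuousOn φc Y) (hcontact : ∀ x ∈ A, ∃ y ∈ Y, φ x + φc y = h (dist x y))
    {t : ℝ} (ht : t ∈ Ioo (0 : ℝ) 1) :
    ENNReal.ofReal (f t) * m A ≤ m (divisionPoints (almostContactSet h φ φc A Y 0) t) := by
  set S : ℕ → Set (X × X) := fun n => almostContactSet h φ φc A Y (1 / (n + 1))
  have hS (n : ℕ) : IsCompact (S n) := isCompact_almostContactSet hconv hmono hA hY hφ hφc _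
  have hanti : Antitone S := fun i j hij p hp =>
    ⟨hp.1, hp.2.trans (by gcongr)⟩
  have hinter : ⋂ n, S n ⊆ almostContactSet h φ φc A Y 0 := by
    intro p hp
    rw [mem_iInter] at hp
    refine ⟨(hp 0).1, ?_⟩
    have hlim := (tendsto_one_div_add_atTop_nhds_zero_nat (𝕜 := ℝ)).const_add (φ p.1 + φc p.2)
    exact ge_of_tendsto' hlim fun n => (hp n).2
  have hmeas := Antitone.measure_iInter (μ := m) (s := fun n => divisionPoints (S n) t)
    (fun i j hij => divisionPoints_mono (hanti hij) t)
    (fun n => ((hS n).divisionPoints t).measurableSet.nullMeasurableSet)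
    ⟨0, ((hS 0).divisionPoints t).measure_lt_top.ne⟩
  calc ENNReal.ofReal (f t) * m A
      ≤ ⨅ n, m (divisionPoints (S n) t) := le_iInf fun n =>
        hm.mul_measure_le_almostContactSet hgeo hnb hconv hmono hA hφ hcontact
          Nat.one_div_pos_of_nat ht
    _ = m (⋂ n, divisionPoints (S n) t) := hmeas.symm
    _ ≤ _ := measure_mono <|
        (divisionPoints_iInter_of_antitone hS hanti t).trans (divisionPoints_mono hinter t)

end Evolution

theorem projection_null_of_disjoint_targets
    {X : Type*} [MetricSpace X] [ProperSpace X] [CompleteSpace X]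
    [TopologicalSpace.SeparableSpace X] [MeasurableSpace X] [BorelSpace X]
    (hgeo : GeodesicMetricSpace X) (hnb : NonBranching X)
    (m : Measure X) [IsFiniteMeasureOnCompacts m]
    (f : ℝ → ℝ) (hm : EvolutionEstimate m f)
    (h : ℝ → ℝ) (hconv : StrictConvexOn ℝ (Set.Ici (0:ℝ)) h)
    (hmono : MonotoneOn h (Set.Ici (0:ℝ))) (hpos : ∀ x ∈ Set.Ici (0:ℝ), 0 ≤ h x)
    (K : Set X) (hK : IsCompact K)
    (φ φc : X → ℝ) (hφ : ContinuousOn φ K) (hφc : ContinuousOn φc K)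
    (hpot : ∀ x ∈ K, ∀ y ∈ K, φ x + φc y ≤ h (dist x y))
    (Λ₁ Λ₂ : Set (X × X)) (hΛ₁cpt : IsCompact Λ₁) (hΛ₂cpt : IsCompact Λ₂)
    (hΛ₁Γ : Λ₁ ⊆ contactSet h φ φc K) (hΛ₂Γ : Λ₂ ⊆ contactSet h φ φc K)
    (hproj : Prod.fst '' Λ₁ = Prod.fst '' Λ₂)
    (hdisj : (Prod.snd '' Λ₁) ∩ (Prod.snd '' Λ₂) = ∅) :
    m (Prod.fst '' Λ₁) = 0 ∧ m (Prod.fst '' Λ₂) = 0 := by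
  rw [← hproj, and_self_iff]
  set A := Prod.fst '' Λ₁ with hA
  have hAc : IsCompact A := hΛ₁cpt.image continuous_fst
  have hAK : A ⊆ K := by
    rintro _ ⟨p, hp, rfl⟩
    exact (hΛ₁Γ hp).1
  have hYc₁ : IsCompact (Prod.snd '' Λ₁) := hΛ₁cpt.image continuous_snd
  have hYc₂ : IsCompact (Prod.snd '' Λ₂) := hΛ₂cpt.image continuous_snd
  have hYK₁ : Prod.snd '' Λ₁ ⊆ K := by
    rintro _ ⟨p, hp, rfl⟩
    exact (hΛ₁Γ hp).2.1
  have hYK₂ : Prod.snd '' Λ₂ ⊆ K := by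
    rintro _ ⟨p, hp, rfl⟩
    exact (hΛ₂Γ hp).2.1
  set S₁ := almostContactSet h φ φc A (Prod.snd '' Λ₁) 0
  set S₂ := almostContactSet h φ φc A (Prod.snd '' Λ₂) 0
  have hS₂c : IsCompact S₂ :=
    isCompact_almostContactSet hconv hmono hAc hYc₂ (hφ.mono hAK) (hφc.mono hYK₂) 0
  have est₁ : ∀ t ∈ Ioo (0 : ℝ) 1, ENNReal.ofReal (f t) * m A ≤ m (divisionPoints S₁ t) :=
    fun t ht => hm.mul_measure_le hgeo hnb hconv hmono hAc hYc₁ (hφ.mono hAK) (hφc.mono hYK₁)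
      (by
        rintro _ ⟨p, hp, rfl⟩
        exact ⟨p.2, mem_image_of_mem _ hp, (hΛ₁Γ hp).2.2⟩) ht
  have est₂ : ∀ t ∈ Ioo (0 : ℝ) 1, ENNReal.ofReal (f t) * m A ≤ m (divisionPoints S₂ t) :=
    fun t ht => hm.mul_measure_le hgeo hnb hconv hmono hAc hYc₂ (hφ.mono hAK) (hφc.mono hYK₂)
      (by
        rw [hproj]
        rintro _ ⟨p, hp, rfl⟩
        exact ⟨p.2, mem_image_of_mem _ hp, (hΛ₂Γ hp).2.2⟩) ht
  have disj : ∀ t ∈ Ioo (0 : ℝ) 1, Disjoint (divisionPoints S₁ t) (divisionPoints S₂ t) := by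
    intro t ht
    refine Set.disjoint_left.2 ?_
    rintro z ⟨p, ⟨⟨hpA, hpY⟩, hp⟩, hd₁, hd₁'⟩ ⟨q, ⟨⟨hqA, hqY⟩, hq⟩, hd₂, hd₂'⟩
    have i₁ := hpot p.1 (hAK hpA) q.2 (hYK₂ hqY)
    have i₂ := hpot q.1 (hAK hqA) p.2 (hYK₁ hpY)
    have heq : p.2 = q.2 := eq_of_common_divisionPoint_of_cost_le hgeo hnb hconv hmono ht
      (by linarith) hd₁ hd₁' hd₂ hd₂'
    have hmem : p.2 ∈ Prod.snd '' Λ₁ ∩ Prod.snd '' Λ₂ := ⟨hpY, heq ▸ hqY⟩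
    rw [hdisj] at hmem
    exact hmem
  have bound : ∀ t ∈ Ioo (0 : ℝ) 1,
      ENNReal.ofReal (f t) * m A + ENNReal.ofReal (f t) * m A ≤
        m (cthickening (t * diam K) A) := by
    intro t ht
    refine (add_le_add (est₁ t ht) (est₂ t ht)).trans ?_
    rw [← measure_union (disj t ht) (hS₂c.divisionPoints t).measurableSet]
    refine measure_mono (union_subset ?_ ?_)
    · exact divisionPoints_subset_cthickening ht.1.le (fun p hp => hp.1.1) fun p hp =>
        dist_le_diam_of_mem hK.isBounded (hAK hp.1.1) (hYK₁ hp.1.2)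
    · exact divisionPoints_subset_cthickening ht.1.le (fun p hp => hp.1.1) fun p hp =>
        dist_le_diam_of_mem hK.isBounded (hAK hp.1.1) (hYK₂ hp.1.2)
  have hfin : m A ≠ ⊤ := hAc.measure_lt_top.ne
  have hf : Filter.Tendsto f (nhdsWithin 0 (Ioo 0 1)) (nhds 1) := by
    have := (hm.1 0 (by simp)).mono Ioo_subset_Icc_self
    rwa [ContinuousWithinAt, hm.2.1] at this
  have hf' : Filter.Tendsto (fun t => ENNReal.ofReal (f t) * m A) (nhdsWithin 0 (Ioo 0 1))
      (nhds (m A)) := by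
    simpa using ENNReal.Tendsto.mul_const (ENNReal.tendsto_ofReal hf) (Or.inr hfin)
  have hthick : Filter.Tendsto (fun t : ℝ => m (cthickening (t * diam K) A))
      (nhdsWithin 0 (Ioo 0 1)) (nhds (m A)) := by
    refine (tendsto_measure_cthickening_of_isCompact hAc).comp ?_
    have hc : Continuous fun t : ℝ => t * diam K := by fun_prop
    simpa using (hc.tendsto 0).mono_left nhdsWithin_le_nhds
  have : (nhdsWithin (0 : ℝ) (Ioo 0 1)).NeBot := left_nhdsWithin_Ioo_neBot zero_lt_one
  have hle : m A + m A ≤ m A := le_of_tendsto_of_tendsto (hf'.add hf') hthick <| by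
    filter_upwards [self_mem_nhdsWithin] with t ht
    exact bound t ht
  by_contra hne
  exact (ENNReal.lt_add_right hfin hne).not_ge hle
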